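/- Let κ₀ = max{κ, 1}. For every m ∈ ℕ, every v₁, v₂ ∈ C([0,τ];H), and every t ∈ [0,τ], ‖(𝔗^m v₁)(t) − (𝔗^m v₂)(t)‖ ≤ ( κ₀ e^{λ_N τ} (1+τ) (τ−t) )^m / m! · max_{0≤s≤τ} ‖v₁(s) − v₂(s)‖; in particular max_{0≤t≤τ} ‖(𝔗^m v₁)(t) − (𝔗^m v₂)(t)‖ ≤ ( κ₀ e^{λ_N τ} (1+τ) τ )^m / m! · max_{0≤s≤τ} ‖v₁(s) − v₂(s)‖. -/

import Mathlib

open MeasureTheory RealInnerProductSpace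

/-- A linear combination of an orthonormal family whose coefficients are the Fourier coefficients
of `ψ` multiplied by factors `c i ∈ [0, C]` has norm at most `C * ‖ψ‖`. -/
theorem Orthonormal.norm_sum_mul_inner_smul_le {ι H : Type*} [NormedAddCommGroup H]
    [InnerProductSpace ℝ H] {v : ι → H} (hv : Orthonormal ℝ v) (s : Finset ι) {c : ι → ℝ} {C : ℝ}
    (hC : 0 ≤ C) (hc : ∀ i ∈ s, 0 ≤ c i ∧ c i ≤ C) (ψ : H) :
    ‖∑ i ∈ s, (c i * ⟪ψ, v i⟫) • v i‖ ≤ C * ‖ψ‖ := by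
  refine le_of_sq_le_sq ?_ (by positivity)
  rw [← real_inner_self_eq_norm_sq, hv.inner_sum, mul_pow]
  calc ∑ i ∈ s, (starRingEnd ℝ) (c i * ⟪ψ, v i⟫) * (c i * ⟪ψ, v i⟫)
      ≤ ∑ i ∈ s, C ^ 2 * ‖⟪v i, ψ⟫‖ ^ 2 := by
        refine Finset.sum_le_sum fun i hi => ?_
        obtain ⟨h0, h1⟩ := hc i hi
        have h2 : c i ^ 2 ≤ C ^ 2 := by gcongr
        rw [real_inner_comm, Real.norm_eq_abs, sq_abs, conj_trivial]
        nlinarith [mul_le_mul_of_nonneg_right h2 (sq_nonneg ⟪ψ, v i⟫),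
          real_inner_comm ψ (v i)]
    _ = C ^ 2 * ∑ i ∈ s, ‖⟪v i, ψ⟫‖ ^ 2 := by rw [Finset.mul_sum]
    _ ≤ C ^ 2 * ‖ψ‖ ^ 2 := by
        gcongr
        exact hv.sum_inner_products_le ψ

/-- The truncated exponential operator `ψ ↦ ∑ j, e^{λ_j r} ⟪ψ, φ_j⟫ φ_j`. -/
noncomputable def truncatedExp {H : Type*} [NormedAddCommGroup H] [InnerProductSpace ℝ H]
    (N : ℕ) (φ : ℕ → H) (lam : ℕ → ℝ) (r : ℝ) (ψ : H) : H :=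
  ∑ j ∈ Finset.Icc 1 N, (Real.exp (lam j * r) * ⟪ψ, φ j⟫) • φ j

namespace truncatedExp

variable {H : Type*} [NormedAddCommGroup H] [InnerProductSpace ℝ H]
  {N : ℕ} {φ : ℕ → H} {lam : ℕ → ℝ}

theorem add_right (r : ℝ) (x y : H) : truncatedExp N φ lam r (x + y) =
    truncatedExp N φ lam r x + truncatedExp N φ lam r y := by
  simp [truncatedExp, inner_add_left, mul_add, add_smul, Finset.sum_add_distrib]

theorem sub_right (r : ℝ) (x y : H) : truncatedExp N φ lam r (x - y) =
    truncatedExp N φ lam r x - truncatedExp N φ lam r y := by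
  simp [truncatedExp, inner_sub_left, mul_sub, sub_smul, Finset.sum_sub_distrib]

theorem norm_le {τ r : ℝ}
    (hφ : ∀ i ∈ Finset.Icc 1 N, ∀ j ∈ Finset.Icc 1 N,
      ⟪φ i, φ j⟫ = if i = j then (1:ℝ) else 0)
    (hlam_pos : 0 < lam 1)
    (hlam_mono : ∀ i j, 1 ≤ i → i ≤ j → j ≤ N → lam i ≤ lam j)
    (hr : r ∈ Set.Icc 0 τ) (ψ : H) :
    ‖truncatedExp N φ lam r ψ‖ ≤ Real.exp (lam N * τ) * ‖ψ‖ := by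
  have hv : Orthonormal ℝ (fun i : Finset.Icc 1 N => φ i) := by
    rw [orthonormal_iff_ite]
    intro i j
    simpa only [Subtype.ext_iff] using hφ i i.2 j j.2
  rw [truncatedExp, ← Finset.sum_coe_sort]
  refine hv.norm_sum_mul_inner_smul_le Finset.univ (c := fun i => Real.exp (lam i * r))
    (Real.exp_pos _).le (fun i _ => ⟨(Real.exp_pos _).le, Real.exp_le_exp.2 ?_⟩) ψ
  have hi := Finset.mem_Icc.1 i.2
  have h1 := hlam_mono 1 i le_rfl hi.1 hi.2
  have h2 := hlam_mono i N hi.1 hi.2 le_rfl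
  exact mul_le_mul h2 hr.2 hr.1 (by linarith)

theorem sub_left_eq_sum (s t : ℝ) (ψ : H) : truncatedExp N φ lam (s - t) ψ =
    ∑ j ∈ Finset.Icc 1 N,
      Real.exp (-(lam j * t)) • (Real.exp (lam j * s) • (⟪ψ, φ j⟫ • φ j)) := by
  refine Finset.sum_congr rfl fun j _ => ?_
  rw [smul_smul, smul_smul, ← Real.exp_add]
  ring_nf

theorem integrableOn_term {τ : ℝ} {f : ℝ → H} (hf : IntegrableOn f (Set.Icc 0 τ)) (j : ℕ) :
    IntegrableOn (fun s => Real.exp (lam j * s) • (⟪f s, φ j⟫ • φ j)) (Set.Icc 0 τ) := by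
  refine IntegrableOn.continuousOn_smul ?_ (by fun_prop) isCompact_Icc
  exact (Integrable.inner_const (𝕜 := ℝ) hf (φ j)).smul_const (φ j)

theorem integrableOn {τ : ℝ} {f : ℝ → H} (hf : IntegrableOn f (Set.Icc 0 τ)) (t : ℝ) :
    IntegrableOn (fun s => truncatedExp N φ lam (s - t) (f s)) (Set.Icc 0 τ) := by
  simp only [sub_left_eq_sum]
  exact integrable_finsetSum _ fun j _ => (integrableOn_term hf j).smul _

end truncatedExp

theorem MeasureTheory.IntegrableOn.intervalIntegrable_of_mem_Icc {E : Type*}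
    [NormedAddCommGroup E] {f : ℝ → E} {a b x y : ℝ} (hf : IntegrableOn f (Set.Icc a b))
    (hx : x ∈ Set.Icc a b) (hy : y ∈ Set.Icc a b) : IntervalIntegrable f volume x y :=
  IntegrableOn.intervalIntegrable (hf.mono_set (Set.uIcc_subset_Icc hx hy))

theorem continuousOn_integral_left {E : Type*} [NormedAddCommGroup E] [NormedSpace ℝ E]
    {f : ℝ → E} {a b : ℝ} (hab : a ≤ b) (hf : IntegrableOn f (Set.Icc a b)) :
    ContinuousOn (fun t => ∫ s in t..b, f s) (Set.Icc a b) := by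
  have h := intervalIntegral.continuousOn_primitive_interval_left (μ := volume) (f := f)
    (a := a) (b := b) (by rwa [Set.uIcc_of_le hab])
  rwa [Set.uIcc_of_le hab] at h

theorem truncatedExp.continuousOn_integral {H : Type*} [NormedAddCommGroup H]
    [InnerProductSpace ℝ H] {N : ℕ} {φ : ℕ → H} {lam : ℕ → ℝ} {τ : ℝ}
    (hτ : 0 ≤ τ) {f : ℝ → H} (hf : IntegrableOn f (Set.Icc 0 τ)) :
    ContinuousOn (fun t => ∫ s in t..τ, truncatedExp N φ lam (s - t) (f s)) (Set.Icc 0 τ) := by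
  have key : Set.EqOn (fun t => ∫ s in t..τ, truncatedExp N φ lam (s - t) (f s))
      (fun t => ∑ j ∈ Finset.Icc 1 N, Real.exp (-(lam j * t)) •
        ∫ s in t..τ, Real.exp (lam j * s) • (⟪f s, φ j⟫ • φ j)) (Set.Icc 0 τ) := by
    intro t ht
    simp only [truncatedExp.sub_left_eq_sum]
    rw [intervalIntegral.integral_finsetSum]
    · simp only [intervalIntegral.integral_smul]
    · intro j _
      exact ((truncatedExp.integrableOn_term hf j).intervalIntegrable_of_mem_Icc ht
        (Set.right_mem_Icc.2 hτ)).smul _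
  refine ContinuousOn.congr ?_ key
  refine continuousOn_finsetSum _ fun j _ => ContinuousOn.smul (by fun_prop) ?_
  exact continuousOn_integral_left hτ (truncatedExp.integrableOn_term hf j)

/-- The Nemytskii operator of a Lipschitz nonlinearity maps continuous functions to integrable
ones. -/
theorem integrableOn_comp_of_lipschitz {H : Type*} [NormedAddCommGroup H] {τ κ : ℝ}
    {F : ℝ → H → H}
    (hF_lip : ∀ s ∈ Set.Icc (0:ℝ) τ, ∀ ψ₁ ψ₂ : H, ‖F s ψ₁ - F s ψ₂‖ ≤ κ * ‖ψ₁ - ψ₂‖)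
    (hF_int : ∃ φ₀ : H, IntegrableOn (fun s => F s φ₀) (Set.Icc 0 τ))
    (hF_meas : ∀ w : ℝ → H, AEStronglyMeasurable w (volume.restrict (Set.Icc 0 τ)) →
      AEStronglyMeasurable (fun s => F s (w s)) (volume.restrict (Set.Icc 0 τ)))
    {w : ℝ → H} (hw : ContinuousOn w (Set.Icc 0 τ)) :
    IntegrableOn (fun s => F s (w s)) (Set.Icc 0 τ) := by
  obtain ⟨φ₀, h₀⟩ := hF_int
  have hm := hF_meas w (hw.aestronglyMeasurable_of_isCompact isCompact_Icc measurableSet_Icc)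
  have hb : IntegrableOn (fun s => κ * ‖w s - φ₀‖) (Set.Icc 0 τ) :=
    ContinuousOn.integrableOn_Icc (by fun_prop)
  have hd : IntegrableOn (fun s => F s (w s) - F s φ₀) (Set.Icc 0 τ) := by
    refine Integrable.mono' hb (hm.sub h₀.aestronglyMeasurable) ?_
    filter_upwards [ae_restrict_mem measurableSet_Icc] with s hs
    exact hF_lip s hs _ _
  exact (Integrable.add hd h₀).congr (ae_of_all _ fun s => sub_add_cancel _ _)

theorem integral_sub_pow_left (m : ℕ) (t τ : ℝ) :
    ∫ s in t..τ, (τ - s) ^ m = (τ - t) ^ (m + 1) / (m + 1) := by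
  rw [intervalIntegral.integral_comp_sub_left (fun x => x ^ m) τ]
  simp [integral_pow]

/-- Contraction estimate for the iterates of `𝔗`: for all `m`, continuous `v₁, v₂` and
`t ∈ [0,τ]`, `‖(𝔗^m v₁)(t) − (𝔗^m v₂)(t)‖ ≤ (κ₀ e^{λ_N τ}(1+τ)(τ−t))^m/m! · max‖v₁−v₂‖`,
and in particular the corresponding bound for the sup over `[0,τ]`. -/
theorem T_iterate_contraction
    {H : Type*} [NormedAddCommGroup H] [InnerProductSpace ℝ H] [CompleteSpace H]
    (τ : ℝ) (hτ : 0 < τ) (N : ℕ) (hN : 1 ≤ N)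
    (φ : ℕ → H)
    (hφ : ∀ i ∈ Finset.Icc 1 N, ∀ j ∈ Finset.Icc 1 N,
      ⟪φ i, φ j⟫ = if i = j then (1:ℝ) else 0)
    (lam : ℕ → ℝ) (hlam_pos : 0 < lam 1)
    (hlam_mono : ∀ i j, 1 ≤ i → i ≤ j → j ≤ N → lam i ≤ lam j)
    (F : ℝ → H → H) (κ : ℝ) (hκ : 0 < κ)
    (hF_lip : ∀ s ∈ Set.Icc (0:ℝ) τ, ∀ ψ₁ ψ₂ : H, ‖F s ψ₁ - F s ψ₂‖ ≤ κ * ‖ψ₁ - ψ₂‖)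
    (hF_int : ∃ φ₀ : H, IntegrableOn (fun s => F s φ₀) (Set.Icc 0 τ))
    (hF_meas : ∀ w : ℝ → H, AEStronglyMeasurable w (volume.restrict (Set.Icc 0 τ)) →
      AEStronglyMeasurable (fun s => F s (w s)) (volume.restrict (Set.Icc 0 τ)))
    (g : H)
    (T : (ℝ → H) → (ℝ → H))
    (hT : ∀ (w : ℝ → H) (t : ℝ), T w t =
      (∑ j ∈ Finset.Icc 1 N, (Real.exp (lam j * (τ - t)) * ⟪g, φ j⟫) • φ j)
      - (∫ s in t..τ, ∑ j ∈ Finset.Icc 1 N, (Real.exp (lam j * (s - t)) * ⟪F s (w s), φ j⟫) • φ j)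
      - (∫ s in t..τ, ∑ j ∈ Finset.Icc 1 N,
          (Real.exp (lam j * (s - t)) * ⟪(∫ ξ in s..τ, w ξ), φ j⟫) • φ j))
    (κ₀ : ℝ) (hκ₀ : κ₀ = max κ 1) :
    ∀ (m : ℕ) (v₁ v₂ : ℝ → H), ContinuousOn v₁ (Set.Icc 0 τ) → ContinuousOn v₂ (Set.Icc 0 τ) →
      (∀ t ∈ Set.Icc (0:ℝ) τ,
        ‖T^[m] v₁ t - T^[m] v₂ t‖ ≤
          (κ₀ * Real.exp (lam N * τ) * (1 + τ) * (τ - t)) ^ m / (Nat.factorial m) *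
            ⨆ s : Set.Icc (0:ℝ) τ, ‖v₁ s - v₂ s‖) ∧
      (⨆ t : Set.Icc (0:ℝ) τ, ‖T^[m] v₁ t - T^[m] v₂ t‖) ≤
        (κ₀ * Real.exp (lam N * τ) * (1 + τ) * τ) ^ m / (Nat.factorial m) *
          ⨆ s : Set.Icc (0:ℝ) τ, ‖v₁ s - v₂ s‖ := by
  have hτ' : τ ∈ Set.Icc 0 τ := Set.right_mem_Icc.2 hτ.le
  have : Nonempty (Set.Icc (0:ℝ) τ) := ⟨⟨τ, hτ'⟩⟩
  have hκ₀1 : 1 ≤ κ₀ := hκ₀ ▸ le_max_right _ _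
  have hκκ₀ : κ ≤ κ₀ := hκ₀ ▸ le_max_left _ _
  have hTS : ∀ (w : ℝ → H) (t : ℝ), T w t = truncatedExp N φ lam (τ - t) g
      - (∫ s in t..τ, truncatedExp N φ lam (s - t) (F s (w s)))
      - ∫ s in t..τ, truncatedExp N φ lam (s - t) (∫ ξ in s..τ, w ξ) := hT
  have hFi := fun (w : ℝ → H) (hw : ContinuousOn w (Set.Icc 0 τ)) =>
    integrableOn_comp_of_lipschitz hF_lip hF_int hF_meas hw
  have hIi : ∀ w : ℝ → H, ContinuousOn w (Set.Icc 0 τ) →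
      IntegrableOn (fun s => ∫ ξ in s..τ, w ξ) (Set.Icc 0 τ) := fun w hw =>
    (continuousOn_integral_left hτ.le hw.integrableOn_Icc).integrableOn_Icc
  have hTc : ∀ w : ℝ → H, ContinuousOn w (Set.Icc 0 τ) → ContinuousOn (T w) (Set.Icc 0 τ) := by
    intro w hw
    rw [funext (hTS w)]
    refine ContinuousOn.sub (ContinuousOn.sub ?_ ?_) ?_
    · unfold truncatedExp
      fun_prop
    · exact truncatedExp.continuousOn_integral hτ.le (hFi w hw)
    · exact truncatedExp.continuousOn_integral hτ.le (hIi w hw)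
  have hIterc : ∀ (m : ℕ) (w : ℝ → H), ContinuousOn w (Set.Icc 0 τ) →
      ContinuousOn (T^[m] w) (Set.Icc 0 τ) := by
    intro m
    induction m with
    | zero => exact fun w hw => hw
    | succ m ih => exact fun w hw => ih _ (hTc w hw)
  have hstep : ∀ (m : ℕ) (A : ℝ) (w₁ w₂ : ℝ → H), 0 ≤ A → ContinuousOn w₁ (Set.Icc 0 τ) →
      ContinuousOn w₂ (Set.Icc 0 τ) →
      (∀ s ∈ Set.Icc 0 τ, ‖w₁ s - w₂ s‖ ≤ A * (τ - s) ^ m) → ∀ t ∈ Set.Icc 0 τ,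
      ‖T w₁ t - T w₂ t‖ ≤
        κ₀ * Real.exp (lam N * τ) * (1 + τ) * A * ((τ - t) ^ (m + 1) / (m + 1)) := by
    intro m A w₁ w₂ hA hw₁ hw₂ hw t ht
    have hS : ∀ {f : ℝ → H}, IntegrableOn f (Set.Icc 0 τ) → IntervalIntegrable
        (fun s => truncatedExp N φ lam (s - t) (f s)) volume t τ := fun hf =>
      (truncatedExp.integrableOn hf t).intervalIntegrable_of_mem_Icc ht hτ'
    have hdiff : T w₁ t - T w₂ t = -∫ s in t..τ, truncatedExp N φ lam (s - t)
        ((F s (w₁ s) - F s (w₂ s)) + ((∫ ξ in s..τ, w₁ ξ) - ∫ ξ in s..τ, w₂ ξ)) := by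
      simp only [truncatedExp.add_right, truncatedExp.sub_right]
      rw [intervalIntegral.integral_add ((hS (hFi w₁ hw₁)).sub (hS (hFi w₂ hw₂)))
          ((hS (hIi w₁ hw₁)).sub (hS (hIi w₂ hw₂))),
        intervalIntegral.integral_sub (hS (hFi w₁ hw₁)) (hS (hFi w₂ hw₂)),
        intervalIntegral.integral_sub (hS (hIi w₁ hw₁)) (hS (hIi w₂ hw₂)), hTS, hTS]
      abel
    rw [hdiff, norm_neg, ← integral_sub_pow_left, ← intervalIntegral.integral_const_mul]
    refine intervalIntegral.norm_integral_le_of_norm_le ht.2 (ae_of_all _ fun s hs => ?_)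
      (Continuous.intervalIntegrable (by fun_prop) _ _)
    have hs' : s ∈ Set.Icc 0 τ := ⟨ht.1.trans hs.1.le, hs.2⟩
    have hτs : 0 ≤ τ - s := sub_nonneg.2 hs.2
    have hp : 0 ≤ A * (τ - s) ^ m := by positivity
    have hF : ‖F s (w₁ s) - F s (w₂ s)‖ ≤ κ₀ * (A * (τ - s) ^ m) :=
      (hF_lip s hs' _ _).trans (mul_le_mul hκκ₀ (hw s hs') (norm_nonneg _) (by linarith))
    have hI : ‖(∫ ξ in s..τ, w₁ ξ) - ∫ ξ in s..τ, w₂ ξ‖ ≤ κ₀ * (τ * (A * (τ - s) ^ m)) := by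
      rw [← intervalIntegral.integral_sub
        (hw₁.integrableOn_Icc.intervalIntegrable_of_mem_Icc hs' hτ')
        (hw₂.integrableOn_Icc.intervalIntegrable_of_mem_Icc hs' hτ')]
      have h := intervalIntegral.norm_integral_le_of_norm_le_const (a := s) (b := τ)
        (f := fun ξ => w₁ ξ - w₂ ξ) (C := A * (τ - s) ^ m) (fun ξ hξ => by
          rw [Set.uIoc_of_le hs.2] at hξ
          refine (hw ξ ⟨hs'.1.trans hξ.1.le, hξ.2⟩).trans ?_
          have h0 : 0 ≤ τ - ξ := sub_nonneg.2 hξ.2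
          have h1 : τ - ξ ≤ τ - s := by linarith [hξ.1]
          gcongr)
      rw [abs_of_nonneg hτs] at h
      have h1 : A * (τ - s) ^ m * (τ - s) ≤ A * (τ - s) ^ m * τ :=
        mul_le_mul_of_nonneg_left (by linarith [hs'.1]) hp
      have h2 : 0 ≤ τ * (A * (τ - s) ^ m) := by positivity
      nlinarith [mul_le_mul_of_nonneg_right hκ₀1 h2]
    calc _ ≤ Real.exp (lam N * τ) * ‖(F s (w₁ s) - F s (w₂ s)) +
          ((∫ ξ in s..τ, w₁ ξ) - ∫ ξ in s..τ, w₂ ξ)‖ :=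
          truncatedExp.norm_le hφ hlam_pos hlam_mono
            ⟨sub_nonneg.2 hs.1.le, by linarith [ht.1, hs.2]⟩ _
      _ ≤ Real.exp (lam N * τ) *
          (κ₀ * (A * (τ - s) ^ m) + κ₀ * (τ * (A * (τ - s) ^ m))) :=
          mul_le_mul_of_nonneg_left ((norm_add_le _ _).trans (add_le_add hF hI))
            (Real.exp_pos _).le
      _ = _ := by ring
  intro m v₁ v₂ hv₁ hv₂
  set C := κ₀ * Real.exp (lam N * τ) * (1 + τ)
  set M := ⨆ s : Set.Icc (0:ℝ) τ, ‖v₁ s - v₂ s‖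
  have hC0 : 0 ≤ C := by positivity
  clear_value C
  have hM0 : 0 ≤ M := Real.iSup_nonneg fun _ => norm_nonneg _
  have hM : ∀ s ∈ Set.Icc 0 τ, ‖v₁ s - v₂ s‖ ≤ M := by
    have hbdd : BddAbove (Set.range fun s : Set.Icc (0:ℝ) τ => ‖v₁ s - v₂ s‖) := by
      have h := isCompact_Icc.bddAbove_image (hv₁.sub hv₂).norm
      rwa [Set.image_eq_range] at h
    exact fun s hs => le_ciSup hbdd ⟨s, hs⟩
  have main : ∀ t ∈ Set.Icc (0:ℝ) τ,
      ‖T^[m] v₁ t - T^[m] v₂ t‖ ≤ (C * (τ - t)) ^ m / (Nat.factorial m) * M := by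
    induction m with
    | zero => simpa using hM
    | succ m ih =>
      intro t ht
      rw [Function.iterate_succ_apply', Function.iterate_succ_apply']
      refine (hstep m (C ^ m / (Nat.factorial m) * M) _ _ (by positivity) (hIterc m _ hv₁)
        (hIterc m _ hv₂) (fun s hs => (ih s hs).trans_eq (by rw [mul_pow]; ring)) t ht).trans_eq ?_
      rw [Nat.factorial_succ]
      push_cast
      field_simp
      rw [mul_pow]
      ring
  refine ⟨main, ciSup_le fun t => (main t t.2).trans ?_⟩
  have h0 : 0 ≤ τ - t := sub_nonneg.2 t.2.2
  have h1 : τ - t ≤ τ := by linarith [t.2.1]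
  gcongr
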